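/- arXiv:1605.02520 — 3 statements merged into one kernel-verified Lean document; each statement's English description precedes it below -/
import Mathlib

section
/- Let $n \ge 1$, $1 < p < \infty$, $k \in \mathbb{N}$, and $\theta \in \mathbb{R}$ such that $\prod_{j=0}^{k-1} |n - p(\theta+1-j)| \ne 0$. Then for all $f \in C_0^\infty(\mathbb{R}^n \setminus \{0\})$, $$\left\|\frac{f}{\|x\|^{\theta+1}}\right\|_{L^p(\mathbb{R}^n)} \le p^k \left[\prod_{j=0}^{k-1} |n - p(\theta+1-j)|\right]^{-1} \left\|\frac{\mathcal{R}^k f}{\|x\|^{\theta+1-k}}\right\|_{L^p(\mathbb{R}^n)},$$ where $\mathcal{R} f(x) = \frac{x}{\|x\|}\cdot \nabla f(x)$. -/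
open MeasureTheory Real Finset

noncomputable def Rop {n : ℕ} (f : EuclideanSpace ℝ (Fin n) → ℂ) :
    EuclideanSpace ℝ (Fin n) → ℂ :=
  fun x => ‖x‖⁻¹ • (fderiv ℝ f x x)

lemma aux_div {n : ℕ} (u : EuclideanSpace ℝ (Fin n) → ℝ) (hu : ContDiff ℝ 1 u)
    (hc : HasCompactSupport u) :
    Integrable (fun x => fderiv ℝ u x x) ∧ ∫ x, fderiv ℝ u x x = -(n : ℝ) * ∫ x, u x := by
  have hcont : Continuous (fderiv ℝ u) := hu.continuous_fderiv one_ne_zero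
  have hcd : HasCompactSupport (fderiv ℝ u) := hc.fderiv ℝ
  let e : Fin n → EuclideanSpace ℝ (Fin n) := fun i => EuclideanSpace.single i 1
  have hexp : ∀ x, fderiv ℝ u x x = ∑ i, x i * fderiv ℝ u x (e i) := by
    intro x
    have hx : x = ∑ i, x i • e i := by
      have := (EuclideanSpace.basisFun (Fin n) ℝ).sum_repr x
      simpa [e] using this.symm
    have h2 := congrArg (fderiv ℝ u x) hx
    rw [map_sum] at h2
    simpa using h2
  have hc2 : ∀ i, HasCompactSupport (fun x => fderiv ℝ u x (e i)) := fun i =>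
    hcd.comp_left (g := fun L : EuclideanSpace ℝ (Fin n) →L[ℝ] ℝ => L (e i)) (by simp)
  have hint : ∀ i, Integrable (fun x : EuclideanSpace ℝ (Fin n) => x i * fderiv ℝ u x (e i)) := by
    intro i
    apply Continuous.integrable_of_hasCompactSupport
    · exact (by fun_prop : Continuous fun x : EuclideanSpace ℝ (Fin n) => x i).mul
        (hcont.clm_apply continuous_const)
    · exact (hc2 i).mul_left
  have hui : Integrable u := hu.continuous.integrable_of_hasCompactSupport hc
  have hd : ∀ (i : Fin n) (x : EuclideanSpace ℝ (Fin n)),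
      HasFDerivAt (fun x : EuclideanSpace ℝ (Fin n) => x i) (EuclideanSpace.proj i : _ →L[ℝ] ℝ) x :=
    fun i x => (EuclideanSpace.proj i : EuclideanSpace ℝ (Fin n) →L[ℝ] ℝ).hasFDerivAt
  have hd1 : ∀ (i : Fin n) (x : EuclideanSpace ℝ (Fin n)),
      fderiv ℝ (fun x : EuclideanSpace ℝ (Fin n) => x i) x (e i) = 1 := by
    intro i x
    rw [(hd i x).fderiv]; simp [e]
  have hibp : ∀ i, ∫ x : EuclideanSpace ℝ (Fin n), x i * fderiv ℝ u x (e i) = - ∫ x, u x := by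
    intro i
    rw [integral_mul_fderiv_eq_neg_fderiv_mul_of_integrable]
    · simp [hd1]
    · simpa [hd1] using hui
    · exact hint i
    · apply Continuous.integrable_of_hasCompactSupport
      · exact (by fun_prop : Continuous fun x : EuclideanSpace ℝ (Fin n) => x i).mul hu.continuous
      · exact hc.mul_left
    · intro x _; exact (hd i x).differentiableAt
    · intro x _; exact (hu.differentiable one_ne_zero) x
  simp_rw [hexp]
  refine ⟨integrable_finsetSum _ fun i _ => hint i, ?_⟩
  rw [integral_finsetSum _ fun i _ => hint i]
  simp [hibp]

lemma aux_hardy {n : ℕ} (p c : ℝ) (hp : 1 < p) (F G : EuclideanSpace ℝ (Fin n) → ℂ)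
    (hF : ContDiff ℝ 1 F) (hFc : HasCompactSupport F) (hG : Continuous G)
    (hGc : HasCompactSupport G)
    (hFG : ∀ x, fderiv ℝ F x x = G x + c • F x) :
    |(n : ℝ) + p * c| * (∫ x, ‖F x‖ ^ p) ^ (1 / p) ≤ p * (∫ x, ‖G x‖ ^ p) ^ (1 / p) := by
  have hp0 : 0 < p := by linarith
  have hu : ContDiff ℝ 1 (fun x => ‖F x‖ ^ p) := hF.norm_rpow hp
  have huc : HasCompactSupport (fun x => ‖F x‖ ^ p) :=
    hFc.comp_left (g := fun z : ℂ => ‖z‖ ^ p) (by simp [hp0.ne'])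
  obtain ⟨hi, hdiv⟩ := aux_div _ hu huc
  have hui : Integrable (fun x => ‖F x‖ ^ p) := hu.continuous.integrable_of_hasCompactSupport huc
  set A := ∫ x, ‖F x‖ ^ p with hA
  set B := ∫ x, ‖G x‖ ^ p with hB
  have hA0 : 0 ≤ A := integral_nonneg fun x => by positivity
  have hB0 : 0 ≤ B := integral_nonneg fun x => by positivity
  have hFp : Continuous (fun x => ‖F x‖ ^ (p - 1)) :=
    hF.continuous.norm.rpow_const fun x => Or.inr (by linarith)
  have hFpc : HasCompactSupport (fun x => ‖F x‖ ^ (p - 1)) :=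
    hFc.comp_left (g := fun z : ℂ => ‖z‖ ^ (p - 1)) (by simp [(sub_pos.2 hp).ne'])
  have hpt : ∀ x, ‖fderiv ℝ (fun x => ‖F x‖ ^ p) x x - p * c * ‖F x‖ ^ p‖ ≤
      p * (‖G x‖ * ‖F x‖ ^ (p - 1)) := by
    intro x
    rw [(hF.differentiable one_ne_zero).fderiv_norm_rpow hp]
    by_cases h : F x = 0
    · simp [h, hp0.ne']
      rw [Real.zero_rpow (by linarith)]; simp
    have hn : 0 < ‖F x‖ := norm_pos_iff.2 h
    have e1 : ‖F x‖ ^ p = ‖F x‖ ^ (p - 2) * ‖F x‖ ^ 2 := by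
      rw [← Real.rpow_natCast, ← Real.rpow_add hn]; norm_num
    have e2 : ‖F x‖ ^ (p - 1) = ‖F x‖ ^ (p - 2) * ‖F x‖ := by
      rw [← Real.rpow_add_one hn.ne']; ring_nf
    have e3 : ((p * ‖F x‖ ^ (p - 2)) • (innerSL ℝ (F x)).comp (fderiv ℝ F x)) x
        - p * c * ‖F x‖ ^ p = p * ‖F x‖ ^ (p - 2) * inner ℝ (F x) (G x) := by
      rw [_root_.smul_apply, ContinuousLinearMap.comp_apply, hFG, innerSL_apply_apply,
        inner_add_right, inner_smul_right, real_inner_self_eq_norm_sq, e1, smul_eq_mul]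
      ring
    rw [e3, norm_mul, Real.norm_of_nonneg (by positivity), e2]
    calc _ ≤ p * ‖F x‖ ^ (p - 2) * (‖F x‖ * ‖G x‖) := by
          gcongr; exact norm_inner_le_norm _ _
      _ = _ := by ring
  have hGi : Integrable (fun x => p * (‖G x‖ * ‖F x‖ ^ (p - 1))) := by
    apply Integrable.const_mul
    exact (hG.norm.mul hFp).integrable_of_hasCompactSupport hFpc.mul_left
  have h1 := norm_integral_le_of_norm_le hGi (Filter.Eventually.of_forall hpt)
  rw [integral_sub hi (hui.const_mul _), hdiv, integral_const_mul, integral_const_mul, ← hA] at h1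
  have hpq : p.HolderConjugate (p / (p - 1)) := Real.HolderConjugate.conjExponent hp
  have h2 := integral_mul_le_Lp_mul_Lq_of_nonneg (μ := volume) hpq (f := fun x => ‖G x‖)
    (g := fun x => ‖F x‖ ^ (p - 1)) (Filter.Eventually.of_forall fun x => by positivity)
    (Filter.Eventually.of_forall fun x => by positivity)
    (hG.norm.memLp_of_hasCompactSupport hGc.norm) (hFp.memLp_of_hasCompactSupport hFpc)
  have e4 : ∀ x, (‖F x‖ ^ (p - 1)) ^ (p / (p - 1)) = ‖F x‖ ^ p := by
    intro x
    rw [← Real.rpow_mul (norm_nonneg _), mul_div_cancel₀ _ (sub_pos.2 hp).ne']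
  simp only [e4] at h2
  rw [← hA, ← hB] at h2
  have h3 : |(n : ℝ) + p * c| * A ≤ p * (B ^ (1 / p) * A ^ (1 / (p / (p - 1)))) := by
    calc _ = ‖-(n : ℝ) * A - p * c * A‖ := by
          have : -(n : ℝ) * A - p * c * A = -(((n : ℝ) + p * c) * A) := by ring
          rw [this, norm_neg, norm_mul, Real.norm_eq_abs, Real.norm_of_nonneg hA0]
      _ ≤ _ := h1.trans (by gcongr)
  rcases hA0.eq_or_lt with h | h
  · rw [← h, Real.zero_rpow (by positivity)]; simp; positivity
  · have e5 : A = A ^ (1 / p) * A ^ (1 / (p / (p - 1))) := by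
      rw [← Real.rpow_add h]
      have : 1 / p + 1 / (p / (p - 1)) = 1 := by field_simp; ring
      rw [this, Real.rpow_one]
    have hpos : 0 < A ^ (1 / (p / (p - 1))) := Real.rpow_pos_of_pos h _
    refine le_of_mul_le_mul_right ?_ hpos
    calc _ = |(n : ℝ) + p * c| * A := by rw [mul_assoc, ← e5]
      _ ≤ _ := h3
      _ = _ := by ring

def Good {n : ℕ} (f : EuclideanSpace ℝ (Fin n) → ℂ) : Prop :=
  ContDiff ℝ (⊤ : ℕ∞) f ∧ HasCompactSupport f ∧ (0 : EuclideanSpace ℝ (Fin n)) ∉ tsupport f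

lemma Good.of_sub {n : ℕ} {f g : EuclideanSpace ℝ (Fin n) → ℂ} (hf : Good f)
    (hg : ContDiff ℝ (⊤ : ℕ∞) g) (h : ∀ x, x ∉ tsupport f → g x = 0) : Good g := by
  have hs : tsupport g ⊆ tsupport f := closure_minimal (fun x hx => by
    by_contra h'; exact hx (h x h')) (isClosed_tsupport f)
  exact ⟨hg, hf.2.1.of_isClosed_subset (isClosed_tsupport g) hs, fun h0 => hf.2.2 (hs h0)⟩

lemma Good.smul {n : ℕ} {f : EuclideanSpace ℝ (Fin n) → ℂ} (hf : Good f) (s : ℝ) :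
    Good (fun x => ‖x‖ ^ s • f x) := by
  refine hf.of_sub ?_ fun x hx => by simp [image_eq_zero_of_notMem_tsupport hx]
  rw [contDiff_iff_contDiffAt]
  intro x
  by_cases hx : x ∈ tsupport f
  · have hx0 : x ≠ 0 := fun h => hf.2.2 (h ▸ hx)
    exact ((contDiffAt_id.norm ℝ hx0).rpow_const_of_ne (norm_ne_zero_iff.2 hx0)).smul
      hf.1.contDiffAt
  · have : (fun x => ‖x‖ ^ s • f x) =ᶠ[nhds x] fun _ => 0 := by
      filter_upwards [notMem_tsupport_iff_eventuallyEq.1 hx] with y hy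
      simp [hy]
    exact contDiffAt_const.congr_of_eventuallyEq this

lemma Good.rop {n : ℕ} {f : EuclideanSpace ℝ (Fin n) → ℂ} (hf : Good f) : Good (Rop f) := by
  have h1 : Good (fun x => fderiv ℝ f x x) := by
    refine hf.of_sub ?_ fun x hx => ?_
    · have := hf.1.fderiv_right (m := ((⊤ : ℕ∞) : WithTop ℕ∞)) (by simp)
      exact this.clm_apply contDiff_id
    · rw [image_eq_zero_of_notMem_tsupport fun h => hx (tsupport_fderiv_subset ℝ h)]; simp
  have := h1.smul (-1)
  simp only [Real.rpow_neg_one] at this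
  exact this

lemma Good.eq {n : ℕ} {f : EuclideanSpace ℝ (Fin n) → ℂ} (hf : Good f) (s p : ℝ) (hp : 0 < p) :
    (∫ x, ‖f x‖ ^ p / ‖x‖ ^ (s * p)) = ∫ x, ‖‖x‖ ^ (-s) • f x‖ ^ p := by
  congr 1; ext x
  rw [norm_smul, Real.norm_of_nonneg (by positivity), Real.mul_rpow (by positivity) (by positivity),
    ← Real.rpow_mul (norm_nonneg _), neg_mul, Real.rpow_neg (norm_nonneg _)]
  field_simp

lemma Good.step {n : ℕ} {f : EuclideanSpace ℝ (Fin n) → ℂ} (hf : Good f) (p θ : ℝ) (hp : 1 < p) :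
    |(n : ℝ) - p * (θ + 1)| * (∫ x, ‖f x‖ ^ p / ‖x‖ ^ ((θ + 1) * p)) ^ (1 / p) ≤
      p * (∫ x, ‖Rop f x‖ ^ p / ‖x‖ ^ (θ * p)) ^ (1 / p) := by
  rw [hf.eq _ _ (by linarith), hf.rop.eq _ _ (by linarith)]
  have hF := hf.smul (-(θ + 1))
  have hG := hf.rop.smul (-θ)
  have := aux_hardy p (-(θ + 1)) hp _ _ (hF.1.of_le (by exact_mod_cast le_top)) hF.2.1
    hG.1.continuous hG.2.1 ?_
  · convert this using 3; ring
  intro x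
  by_cases hx : x = 0
  · subst hx
    simp [image_eq_zero_of_notMem_tsupport hf.2.2, image_eq_zero_of_notMem_tsupport hf.rop.2.2]
  have hx' : ‖x‖ ≠ 0 := norm_ne_zero_iff.2 hx
  have hd : DifferentiableAt ℝ (fun y : EuclideanSpace ℝ (Fin n) => ‖y‖) x :=
    differentiableAt_id.norm ℝ hx
  have h1 := (hd.hasFDerivAt.rpow_const (p := -(θ + 1)) (Or.inl hx')).smul
    ((hf.1.differentiable (by simp)) x).hasFDerivAt
  have h2 := hd.fderiv_norm_self
  have e1 : ‖x‖ ^ (-(θ + 1)) = ‖x‖ ^ (-θ) * ‖x‖⁻¹ := by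
    rw [← Real.rpow_neg_one, ← Real.rpow_add (by positivity)]; ring_nf
  have e2 : ‖x‖ ^ (-(θ + 1) - 1) * ‖x‖ = ‖x‖ ^ (-(θ + 1)) := by
    rw [← Real.rpow_add_one hx']; ring_nf
  have h3 := HasFDerivAt.fderiv h1
  change fderiv ℝ (fun x => ‖x‖ ^ (-(θ + 1)) • f x) x = _ at h3
  rw [h3]
  simp only [_root_.add_apply, _root_.smul_apply,
    ContinuousLinearMap.smulRight_apply, h2, smul_eq_mul, Rop, smul_smul]
  rw [mul_assoc, e2, ← e1]

theorem stmt9 (n : ℕ) (hn : 1 ≤ n) (p θ : ℝ) (hp1 : 1 < p) (k : ℕ)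
    (hprod : ∏ j ∈ Finset.range k, |(n : ℝ) - p * (θ + 1 - j)| ≠ 0)
    (f : EuclideanSpace ℝ (Fin n) → ℂ)
    (hf : ContDiff ℝ (⊤ : ℕ∞) f) (hsupp : HasCompactSupport f)
    (h0 : (0 : EuclideanSpace ℝ (Fin n)) ∉ tsupport f) :
    (∫ x, ‖f x‖ ^ p / ‖x‖ ^ ((θ + 1) * p)) ^ (1 / p) ≤
      p ^ k * (∏ j ∈ Finset.range k, |(n : ℝ) - p * (θ + 1 - j)|)⁻¹ *
        (∫ x, ‖(Rop)^[k] f x‖ ^ p / ‖x‖ ^ ((θ + 1 - k) * p)) ^ (1 / p) := by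
  have hp0 : 0 < p := by linarith
  have hg : Good f := ⟨hf, hsupp, h0⟩
  clear hf hsupp h0
  induction k generalizing f θ with
  | zero => simp
  | succ k ih =>
    rw [Finset.prod_range_succ'] at hprod ⊢
    have e : ∀ j : ℕ, θ + 1 - ((j + 1 : ℕ) : ℝ) = (θ - 1) + 1 - j := by
      intro j; push_cast; ring
    simp only [e] at hprod ⊢
    simp only [Nat.cast_zero, sub_zero] at hprod ⊢
    have h1 := hg.step p θ hp1
    have h2 := ih (θ - 1) (left_ne_zero_of_mul hprod) (Rop f) hg.rop
    rw [sub_add_cancel] at h2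
    have hc : 0 < |(n : ℝ) - p * (θ + 1)| :=
      lt_of_le_of_ne (abs_nonneg _) (right_ne_zero_of_mul hprod).symm
    rw [Function.iterate_succ_apply]
    rw [← le_div_iff₀' hc] at h1
    refine h1.trans ?_
    rw [div_le_iff₀' hc]
    refine (mul_le_mul_of_nonneg_left h2 hp0.le).trans (le_of_eq ?_)
    rw [mul_inv, pow_succ, sub_add_cancel]
    field_simp
end

section
/- Let $n \ge 3$, $\alpha \in \mathbb{R}$, and $k \in \mathbb{N}$, $k \ge 1$, such that $\prod_{j=0}^{k-1} |\frac{n-2}{2} - (\alpha+j)| \ne 0$. Then for all $f \in C_0^\infty(\mathbb{R}^n \setminus \{0\})$, $$\left\|\frac{f}{\|x\|^{k+\alpha}}\right\|_{L^2(\mathbb{R}^n)} \le \left[\prod_{j=0}^{k-1} \left|\frac{n-2}{2} - (\alpha+j)\right|\right]^{-1} \left\|\frac{\mathcal{R}^k f}{\|x\|^{\alpha}}\right\|_{L^2(\mathbb{R}^n)},$$ where $\mathcal{R} f(x) = \frac{x}{\|x\|}\cdot\nabla f(x)$, with equality if and only if $f = 0$. -/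
open MeasureTheory Real Finset

abbrev EE (n : ℕ) := EuclideanSpace ℝ (Fin n)

lemma aux_smooth {n : ℕ} {F : Type*} [NormedAddCommGroup F] [NormedSpace ℝ F] (u : EE n → F)
    (w : EE n → ℝ) (hu : ContDiff ℝ (⊤ : ℕ∞) u) (h0 : (0 : EE n) ∉ tsupport u)
    (hw : ∀ x, x ≠ 0 → ContDiffAt ℝ (⊤ : ℕ∞) w x) :
    ContDiff ℝ (⊤ : ℕ∞) (fun x => w x • u x) := by
  rw [contDiff_iff_contDiffAt]
  intro x
  by_cases hx : x ∈ tsupport u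
  · have : x ≠ 0 := fun h => h0 (h ▸ hx)
    exact (hw x this).smul hu.contDiffAt
  · have h := notMem_tsupport_iff_eventuallyEq.mp hx
    have : (fun x => w x • u x) =ᶠ[nhds x] fun _ => 0 := by
      filter_upwards [h] with y hy
      simp [hy]
    exact contDiffAt_const.congr_of_eventuallyEq this

lemma aux_w {n : ℕ} (β : ℝ) (x : EE n) (hx : x ≠ 0) :
    ContDiffAt ℝ (⊤ : ℕ∞) (fun x : EE n => (‖x‖ ^ 2) ^ (-β)) x := by
  apply ContDiffAt.rpow_const_of_ne
  · exact (contDiff_norm_sq ℝ).contDiffAt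
  · simpa using hx

lemma aux_div_s13 {n : ℕ} (g : EE n → ℝ) (hg : ContDiff ℝ (⊤ : ℕ∞) g) (hs : HasCompactSupport g) :
    ∫ x, fderiv ℝ g x x = - (n : ℝ) * ∫ x, g x := by
  have hg1 : Continuous (fderiv ℝ g) := hg.continuous_fderiv (by simp)
  have hs1 : HasCompactSupport (fderiv ℝ g) := hs.fderiv ℝ
  let b := EuclideanSpace.basisFun (Fin n) ℝ
  have hexp : ∀ x : EE n, fderiv ℝ g x x = ∑ i, x i * fderiv ℝ g x (b i) := by
    intro x
    have hx := congrArg (fderiv ℝ g x) (b.sum_repr x)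
    rw [map_sum] at hx
    rw [← hx]
    simp [b]
  have hint : ∀ i, Integrable (fun x : EE n => x i * fderiv ℝ g x (b i)) := by
    intro i
    apply Continuous.integrable_of_hasCompactSupport
    · fun_prop
    · apply HasCompactSupport.mul_left
      exact hs1.comp_left (g := fun L : EE n →L[ℝ] ℝ => L (b i)) (by simp)
  simp_rw [hexp]
  rw [integral_finsetSum _ (fun i _ => hint i)]
  have : ∀ i, ∫ x : EE n, x i * fderiv ℝ g x (b i) = - ∫ x, g x := by
    intro i
    have hd : ∀ x : EE n, fderiv ℝ (fun y : EE n => y i) x = EuclideanSpace.proj i := by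
      intro x
      exact (EuclideanSpace.proj (𝕜 := ℝ) i : EE n →L[ℝ] ℝ).fderiv
    have h1 : ∀ x : EE n, fderiv ℝ (fun y : EE n => y i) x (b i) * g x = g x := by
      intro x; rw [hd]; simp [b]
    rw [integral_mul_fderiv_eq_neg_fderiv_mul_of_integrable]
    · simp_rw [h1]
    · simp_rw [h1]
      exact hg.continuous.integrable_of_hasCompactSupport hs
    · exact hint i
    · apply Continuous.integrable_of_hasCompactSupport
      · have := hg.continuous
        fun_prop
      · exact hs.mul_left
    · fun_prop
    · exact fun x _ => hg.differentiable (by simp) x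
  simp [this]

structure PP {n : ℕ} (f : EE n → ℂ) : Prop where
  smooth : ContDiff ℝ (⊤ : ℕ∞) f
  cs : HasCompactSupport f
  zero : (0 : EE n) ∉ tsupport f

lemma PP.rop {n : ℕ} {f : EE n → ℂ} (h : PP f) : PP (Rop f) := by
  have hs : ContDiff ℝ (⊤ : ℕ∞) (fun x => fderiv ℝ f x x) :=
    (h.smooth.fderiv_right (m := (⊤ : ℕ∞)) (by simp)).clm_apply contDiff_id
  have hsub : Function.support (fun x => fderiv ℝ f x x) ⊆ tsupport f := by
    intro x hx
    apply support_fderiv_subset ℝ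
    intro h'
    apply hx
    simp [h']
  have hsub2 : Function.support (Rop f) ⊆ tsupport f := by
    intro x hx
    apply hsub
    intro h'
    apply hx
    simp only [Rop] at *
    rw [h', smul_zero]
  have ht : tsupport (Rop f) ⊆ tsupport f := closure_minimal hsub2 (isClosed_tsupport f)
  have ht2 : tsupport (fun x => fderiv ℝ f x x) ⊆ tsupport f :=
    closure_minimal hsub (isClosed_tsupport f)
  refine ⟨?_, h.cs.mono' hsub2, fun hx => h.zero (ht hx)⟩
  exact aux_smooth _ (fun x => ‖x‖⁻¹) hs (fun hx => h.zero (ht2 hx))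
    (fun x hx => (contDiffAt_norm ℝ hx).inv (by simpa using hx))

/-- weight facts -/
lemma PP.good {n : ℕ} {f : EE n → ℂ} (h : PP f) (β : ℝ) (u : EE n → ℝ)
    (hu : ContDiff ℝ (⊤ : ℕ∞) u) (hz : ∀ x, f x = 0 → u x = 0) :
    ContDiff ℝ (⊤ : ℕ∞) (fun x => (‖x‖ ^ 2) ^ (-β) * u x) ∧
    HasCompactSupport (fun x => (‖x‖ ^ 2) ^ (-β) * u x) := by
  have hsub : Function.support u ⊆ Function.support f := by
    intro x hx h'
    exact hx (hz x h')
  have hsub' : tsupport u ⊆ tsupport f := closure_mono hsub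
  refine ⟨aux_smooth u _ hu (fun hx => h.zero (hsub' hx)) (aux_w β), ?_⟩
  have : HasCompactSupport u := h.cs.mono hsub
  exact this.mul_left

lemma PP.good_int {n : ℕ} {f : EE n → ℂ} (h : PP f) (β : ℝ) (u : EE n → ℝ)
    (hu : Continuous u) (hz : ∀ x, x ∉ tsupport f → u x = 0) :
    Continuous (fun x => (‖x‖ ^ 2) ^ (-β) * u x) ∧
    Integrable (fun x => (‖x‖ ^ 2) ^ (-β) * u x) := by
  have hc : Continuous (fun x => (‖x‖ ^ 2) ^ (-β) * u x) := by
    rw [continuous_iff_continuousAt]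
    intro x
    by_cases hx : x ∈ tsupport f
    · have : x ≠ 0 := fun h' => h.zero (h' ▸ hx)
      exact (aux_w β x this).continuousAt.mul hu.continuousAt
    · have : (fun x => (‖x‖ ^ 2) ^ (-β) * u x) =ᶠ[nhds x] fun _ => 0 := by
        filter_upwards [(isClosed_tsupport f).isOpen_compl.mem_nhds hx] with y hy
        simp [hz y hy]
      exact continuousAt_const.congr this.symm
  refine ⟨hc, hc.integrable_of_hasCompactSupport ?_⟩
  apply h.cs.mono'
  intro x hx
  by_contra h'
  exact hx (by simp [hz x h'])

lemma PP.ident {n : ℕ} {f : EE n → ℂ} (h : PP f) (β : ℝ) :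
    ((n : ℝ) / 2 - β) * ∫ x, (‖x‖ ^ 2) ^ (-β) * ‖f x‖ ^ 2 =
      - ∫ x, (‖x‖ ^ 2) ^ (-β) * inner ℝ (f x) (fderiv ℝ f x x) := by
  obtain ⟨h1, h2⟩ := h.good β (fun x => ‖f x‖ ^ 2) (h.smooth.norm_sq ℝ) (by simp +contextual)
  have hd := aux_div_s13 _ h1 h2
  have hc1 : Continuous (fderiv ℝ f) := h.smooth.continuous_fderiv (by simp)
  have hc := h.smooth.continuous
  have hz : ∀ x, x ∉ tsupport f → f x = 0 := fun x hx => image_eq_zero_of_notMem_tsupport hx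
  have i1 := (h.good_int β (fun x => ‖f x‖ ^ 2) (by fun_prop) (fun x hx => by simp [hz x hx])).2
  have i2 := (h.good_int β (fun x => inner ℝ (f x) (fderiv ℝ f x x)) (by fun_prop)
    (fun x hx => by simp [hz x hx])).2
  have key : ∀ x, fderiv ℝ (fun x => (‖x‖ ^ 2) ^ (-β) * ‖f x‖ ^ 2) x x =
      2 * ((‖x‖ ^ 2) ^ (-β) * inner ℝ (f x) (fderiv ℝ f x x))
        + (-2 * β) * ((‖x‖ ^ 2) ^ (-β) * ‖f x‖ ^ 2) := by
    intro x
    by_cases hx : x = 0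
    · subst hx
      have := hz 0 h.zero
      simp [this]
    have d1 := (h.smooth.differentiable (by simp) x).hasFDerivAt.norm_sq
    have hx2 : ‖x‖ ^ 2 ≠ 0 := by simpa using hx
    have d2 := (hasStrictFDerivAt_norm_sq x).hasFDerivAt.rpow_const (p := -β) (Or.inl hx2)
    have d : HasFDerivAt (fun x => (‖x‖ ^ 2) ^ (-β) * ‖f x‖ ^ 2) _ x := d2.mul d1
    rw [d.fderiv]
    simp only [ContinuousLinearMap.add_apply, ContinuousLinearMap.smul_apply,
      ContinuousLinearMap.comp_apply, innerSL_apply_apply, smul_eq_mul, nsmul_eq_mul,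
      real_inner_self_eq_norm_sq]
    rw [Real.rpow_sub_one hx2]
    field_simp
    push_cast
    ring
  simp_rw [key] at hd
  rw [integral_add (i2.const_mul 2) (i1.const_mul _), integral_const_mul, integral_const_mul] at hd
  linarith

lemma PP.eq_zero {n : ℕ} {f : EE n → ℂ} (h : PP f) (β : ℝ)
    (hi : ∫ x, (‖x‖ ^ 2) ^ (-β) * ‖f x‖ ^ 2 = 0) : f = 0 := by
  have hc := h.smooth.continuous
  have hz : ∀ x, x ∉ tsupport f → f x = 0 := fun x hx => image_eq_zero_of_notMem_tsupport hx
  obtain ⟨c1, i1⟩ := h.good_int β (fun x => ‖f x‖ ^ 2) (by fun_prop) (fun x hx => by simp [hz x hx])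
  rw [integral_eq_zero_iff_of_nonneg (fun x => by positivity) i1] at hi
  have := (Continuous.ae_eq_iff_eq _ c1 continuous_zero).mp hi
  funext x
  by_cases hx : x = 0
  · subst hx; exact hz 0 h.zero
  have hx' := congrFun this x
  have hx2 : (0:ℝ) < ‖x‖ ^ 2 := by positivity
  have := Real.rpow_pos_of_pos hx2 (-β)
  simpa [this.ne'] using hx'

lemma PP.step {n : ℕ} {f : EE n → ℂ} (h : PP f) (β : ℝ) :
    ((n : ℝ) / 2 - β) ^ 2 * ∫ x, (‖x‖ ^ 2) ^ (-β) * ‖f x‖ ^ 2 ≤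
      ∫ x, (‖x‖ ^ 2) ^ (-β) * ‖fderiv ℝ f x x‖ ^ 2 ∧
    (((n : ℝ) / 2 - β) ^ 2 * ∫ x, (‖x‖ ^ 2) ^ (-β) * ‖f x‖ ^ 2 =
      ∫ x, (‖x‖ ^ 2) ^ (-β) * ‖fderiv ℝ f x x‖ ^ 2 → f = 0) := by
  set c := (n : ℝ) / 2 - β with hcdef
  have hid := h.ident β
  rw [← hcdef] at hid
  have hc1 : Continuous (fderiv ℝ f) := h.smooth.continuous_fderiv (by simp)
  have hc := h.smooth.continuous
  have hz : ∀ x, x ∉ tsupport f → f x = 0 := fun x hx => image_eq_zero_of_notMem_tsupport hx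
  have hz1 : ∀ x, x ∉ tsupport f → fderiv ℝ f x = 0 := by
    intro x hx
    by_contra h'
    exact hx (support_fderiv_subset ℝ h')
  have i1 := (h.good_int β (fun x => ‖f x‖ ^ 2) (by fun_prop) (fun x hx => by simp [hz x hx])).2
  have i2 := (h.good_int β (fun x => inner ℝ (f x) (fderiv ℝ f x x)) (by fun_prop)
    (fun x hx => by simp [hz x hx])).2
  have i3 := (h.good_int β (fun x => ‖fderiv ℝ f x x‖ ^ 2) (by fun_prop)
    (fun x hx => by simp [hz1 x hx])).2
  obtain ⟨c4, i4⟩ := (h.good_int β (fun x => ‖fderiv ℝ f x x + c • f x‖ ^ 2) (by fun_prop)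
    (fun x hx => by simp [hz1 x hx, hz x hx]))
  have e4 : ∫ x, (‖x‖ ^ 2) ^ (-β) * ‖fderiv ℝ f x x + c • f x‖ ^ 2 =
      (∫ x, (‖x‖ ^ 2) ^ (-β) * ‖fderiv ℝ f x x‖ ^ 2)
       - c ^ 2 * ∫ x, (‖x‖ ^ 2) ^ (-β) * ‖f x‖ ^ 2 := by
    have : ∀ x, (‖x‖ ^ 2) ^ (-β) * ‖fderiv ℝ f x x + c • f x‖ ^ 2 =
       (‖x‖ ^ 2) ^ (-β) * ‖fderiv ℝ f x x‖ ^ 2 +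
       (2 * c * ((‖x‖ ^ 2) ^ (-β) * inner ℝ (f x) (fderiv ℝ f x x)) +
       c ^ 2 * ((‖x‖ ^ 2) ^ (-β) * ‖f x‖ ^ 2)) := by
      intro x
      rw [norm_add_sq_real, inner_smul_right, norm_smul, mul_pow, real_inner_comm,
        Real.norm_eq_abs, sq_abs]
      ring
    simp_rw [this]
    have i5 : Integrable (fun x => 2 * c * ((‖x‖ ^ 2) ^ (-β) * inner ℝ (f x) (fderiv ℝ f x x)) +
       c ^ 2 * ((‖x‖ ^ 2) ^ (-β) * ‖f x‖ ^ 2)) := (i2.const_mul _).add (i1.const_mul _)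
    rw [integral_add i3 i5, integral_add (i2.const_mul _) (i1.const_mul _), integral_const_mul, integral_const_mul]
    linear_combination (2 * c) * hid
  have hpos : 0 ≤ ∫ x, (‖x‖ ^ 2) ^ (-β) * ‖fderiv ℝ f x x + c • f x‖ ^ 2 :=
    integral_nonneg (fun x => by positivity)
  refine ⟨by linarith, fun heq => ?_⟩
  have h4 : ∫ x, (‖x‖ ^ 2) ^ (-β) * ‖fderiv ℝ f x x + c • f x‖ ^ 2 = 0 := by
    rw [e4]; linarith
  rw [integral_eq_zero_iff_of_nonneg (fun x => by positivity) i4] at h4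
  have h5 := (Continuous.ae_eq_iff_eq _ c4 continuous_zero).mp h4
  have h6 : ∀ x, fderiv ℝ f x x = - (c • f x) := by
    intro x
    by_cases hx : x = 0
    · subst hx; simp [hz 0 h.zero]
    have hx' := congrFun h5 x
    have hx2 : (0:ℝ) < ‖x‖ ^ 2 := by positivity
    have := Real.rpow_pos_of_pos hx2 (-β)
    apply eq_neg_of_add_eq_zero_left
    simpa [this.ne'] using hx'
  have hid2 := h.ident (β + 1)
  have : ∀ x, (‖x‖ ^ 2) ^ (-(β+1)) * inner ℝ (f x) (fderiv ℝ f x x) =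
      -c * ((‖x‖ ^ 2) ^ (-(β+1)) * ‖f x‖ ^ 2) := by
    intro x
    rw [h6, inner_neg_right, inner_smul_right, real_inner_self_eq_norm_sq]
    ring
  simp_rw [this] at hid2
  rw [integral_const_mul] at hid2
  apply h.eq_zero (β + 1)
  linear_combination -hid2 - hcdef * ∫ x, (‖x‖ ^ 2) ^ (-(β+1)) * ‖f x‖ ^ 2

lemma conv {n : ℕ} (x : EE n) (a β : ℝ) :
    a / ‖x‖ ^ (2 * β) = (‖x‖ ^ 2) ^ (-β) * a := by
  rw [Real.rpow_mul (norm_nonneg _), Real.rpow_neg (by positivity)]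
  simp only [Real.rpow_two]
  ring

lemma PP.step' {n : ℕ} {f : EE n → ℂ} (h : PP f) (α : ℝ) :
    (((n : ℝ) - 2) / 2 - α) ^ 2 * ∫ x, ‖f x‖ ^ 2 / ‖x‖ ^ (2 * (1 + α)) ≤
      ∫ x, ‖Rop f x‖ ^ 2 / ‖x‖ ^ (2 * α) ∧
    ((((n : ℝ) - 2) / 2 - α) ^ 2 * ∫ x, ‖f x‖ ^ 2 / ‖x‖ ^ (2 * (1 + α)) =
      ∫ x, ‖Rop f x‖ ^ 2 / ‖x‖ ^ (2 * α) → f = 0) := by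
  have hs := h.step (1 + α)
  have e : ∀ x, ‖Rop f x‖ ^ 2 / ‖x‖ ^ (2 * α) =
      (‖x‖ ^ 2) ^ (-(1 + α)) * ‖fderiv ℝ f x x‖ ^ 2 := by
    intro x
    rw [conv]
    by_cases hx : x = 0
    · subst hx; simp [Rop]
    have hx2 : ‖x‖ ^ 2 ≠ 0 := by simpa using hx
    rw [show -(1 + α) = -α - 1 by ring, Real.rpow_sub_one hx2, Rop, norm_smul]
    simp only [norm_inv, norm_norm]
    field_simp
  simp_rw [e, conv]
  have : ((n : ℝ) - 2) / 2 - α = n / 2 - (1 + α) := by ring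
  rw [this]
  exact hs

lemma PP.main {n : ℕ} (α : ℝ) (k : ℕ)
    (hprod : ∏ j ∈ Finset.range k, |((n : ℝ) - 2) / 2 - (α + j)| ≠ 0) :
    ∀ f : EE n → ℂ, PP f →
    (∏ j ∈ Finset.range k, |((n : ℝ) - 2) / 2 - (α + j)|) ^ 2 *
      ∫ x, ‖f x‖ ^ 2 / ‖x‖ ^ (2 * ((k : ℝ) + α)) ≤
      ∫ x, ‖(Rop)^[k] f x‖ ^ 2 / ‖x‖ ^ (2 * α) ∧
    (1 ≤ k → (∏ j ∈ Finset.range k, |((n : ℝ) - 2) / 2 - (α + j)|) ^ 2 *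
      ∫ x, ‖f x‖ ^ 2 / ‖x‖ ^ (2 * ((k : ℝ) + α)) =
      ∫ x, ‖(Rop)^[k] f x‖ ^ 2 / ‖x‖ ^ (2 * α) → f = 0) := by
  induction k with
  | zero => intro f hf; simp
  | succ k ih =>
    intro f hf
    rw [Finset.prod_range_succ] at hprod ⊢
    have hp := left_ne_zero_of_mul hprod
    obtain ⟨h1, -⟩ := ih hp (Rop f) hf.rop
    obtain ⟨h2, h3⟩ := hf.step' (α + k)
    rw [show 1 + (α + (k:ℝ)) = ((k + 1 : ℕ) : ℝ) + α by push_cast; ring,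
      show α + (k:ℝ) = k + α by ring] at h2 h3
    rw [show α + (k:ℝ) = k + α by ring, Function.iterate_succ_apply, mul_pow, sq_abs, mul_assoc]
    have hp2 : 0 < (∏ j ∈ Finset.range k, |((n : ℝ) - 2) / 2 - (α + j)|) ^ 2 := by positivity
    have h4 := mul_le_mul_of_nonneg_left h2 hp2.le
    refine ⟨h4.trans h1, fun _ heq => h3 ?_⟩
    apply le_antisymm h2
    apply le_of_mul_le_mul_left _ hp2
    linarith

theorem stmt13 (n : ℕ) (hn : 3 ≤ n) (α : ℝ) (k : ℕ) (hk : 1 ≤ k)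
    (hprod : ∏ j ∈ Finset.range k, |((n : ℝ) - 2) / 2 - (α + j)| ≠ 0)
    (f : EuclideanSpace ℝ (Fin n) → ℂ)
    (hf : ContDiff ℝ (⊤ : ℕ∞) f) (hsupp : HasCompactSupport f)
    (h0 : (0 : EuclideanSpace ℝ (Fin n)) ∉ tsupport f) :
    (∫ x, ‖f x‖ ^ 2 / ‖x‖ ^ (2 * ((k : ℝ) + α))) ^ ((1 : ℝ) / 2) ≤
      (∏ j ∈ Finset.range k, |((n : ℝ) - 2) / 2 - (α + j)|)⁻¹ *
        (∫ x, ‖(Rop)^[k] f x‖ ^ 2 / ‖x‖ ^ (2 * α)) ^ ((1 : ℝ) / 2) ∧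
    ((∫ x, ‖f x‖ ^ 2 / ‖x‖ ^ (2 * ((k : ℝ) + α))) ^ ((1 : ℝ) / 2) =
      (∏ j ∈ Finset.range k, |((n : ℝ) - 2) / 2 - (α + j)|)⁻¹ *
        (∫ x, ‖(Rop)^[k] f x‖ ^ 2 / ‖x‖ ^ (2 * α)) ^ ((1 : ℝ) / 2) ↔ f = 0) := by
  have P : PP f := ⟨hf, hsupp, h0⟩
  obtain ⟨h1, h2⟩ := PP.main α k hprod f P
  have hA : 0 ≤ ∫ x, ‖f x‖ ^ 2 / ‖x‖ ^ (2 * ((k : ℝ) + α)) :=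
    integral_nonneg (fun x => by positivity)
  have hB : 0 ≤ ∫ x, ‖(Rop)^[k] f x‖ ^ 2 / ‖x‖ ^ (2 * α) :=
    integral_nonneg (fun x => by positivity)
  have hR0 : (Rop)^[k] (0 : EuclideanSpace ℝ (Fin n) → ℂ) = 0 := by
    apply Function.iterate_fixed
    funext x
    simp [Rop]
  have hp : 0 < ∏ j ∈ Finset.range k, |((n : ℝ) - 2) / 2 - (α + j)| :=
    lt_of_le_of_ne (Finset.prod_nonneg (fun _ _ => abs_nonneg _)) hprod.symm
  simp only [← Real.sqrt_eq_rpow]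
  refine ⟨?_, ?_, ?_⟩
  · rw [le_inv_mul_iff₀ hp]
    apply Real.le_sqrt_of_sq_le
    rw [mul_pow, Real.sq_sqrt hA]
    exact h1
  · intro heq
    apply h2 hk
    rw [eq_inv_mul_iff_mul_eq₀ hp.ne'] at heq
    have := congrArg (· ^ 2) heq
    simpa only [mul_pow, Real.sq_sqrt hA, Real.sq_sqrt hB] using this
  · intro hf0
    subst hf0
    rw [hR0]
    simp
end

section
/- Let $n \ge 1$, $\alpha \in \mathbb{R}$ with $\alpha \ne \frac{n-2}{2}$. Then for all $f \in C_0^\infty(\mathbb{R}^n \setminus \{0\})$, $$\frac{|n-2-2\alpha|}{2}\left\|\frac{f}{\|x\|^{\alpha+1}}\right\|_{L^2(\mathbb{R}^n)} \le \left\|\frac{1}{\|x\|^{\alpha}} \frac{x}{\|x\|}\cdot\nabla f\right\|_{L^2(\mathbb{R}^n)}.$$ -/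
open MeasureTheory Real Finset

lemma euler_int {n : ℕ} (g : EuclideanSpace ℝ (Fin n) → ℝ) (hg : ContDiff ℝ 1 g)
    (hs : HasCompactSupport g) :
    ∫ x, fderiv ℝ g x x = -(n : ℝ) * ∫ x, g x := by
  have hc : Continuous (fderiv ℝ g) := hg.continuous_fderiv one_ne_zero
  have hcs : HasCompactSupport (fderiv ℝ g) := hs.fderiv ℝ
  have key : ∀ i : Fin n, Integrable (fun x : EuclideanSpace ℝ (Fin n) =>
      x i * fderiv ℝ g x (EuclideanSpace.single i 1)) ∧
      ∫ x : EuclideanSpace ℝ (Fin n), x i * fderiv ℝ g x (EuclideanSpace.single i 1)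
        = - ∫ x, g x := by
    intro i
    have hcoord : ∀ x : EuclideanSpace ℝ (Fin n), HasFDerivAt
        (fun x : EuclideanSpace ℝ (Fin n) => x i)
        (EuclideanSpace.proj i : EuclideanSpace ℝ (Fin n) →L[ℝ] ℝ) x := fun x =>
      (EuclideanSpace.proj i : EuclideanSpace ℝ (Fin n) →L[ℝ] ℝ).hasFDerivAt
    have hfd : ∀ x : EuclideanSpace ℝ (Fin n), fderiv ℝ
        (fun x : EuclideanSpace ℝ (Fin n) => x i) x (EuclideanSpace.single i 1) = 1 := by
      intro x
      rw [(hcoord x).fderiv]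
      simp
    have hcc : Continuous (fun x : EuclideanSpace ℝ (Fin n) => x i) := by fun_prop
    have hDe : HasCompactSupport
        (fun x => fderiv ℝ g x (EuclideanSpace.single i (1 : ℝ))) :=
      hs.fderiv_apply ℝ _
    have h1 : Integrable (fun x : EuclideanSpace ℝ (Fin n) =>
        x i * fderiv ℝ g x (EuclideanSpace.single i 1)) := by
      apply Continuous.integrable_of_hasCompactSupport
      · exact hcc.mul (hc.clm_apply continuous_const)
      · exact hDe.mul_left
    refine ⟨h1, ?_⟩
    rw [integral_mul_fderiv_eq_neg_fderiv_mul_of_integrable (𝕜 := ℝ) _ h1 _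
      (fun x _ => (hcoord x).differentiableAt)
      (fun x _ => (hg.differentiable one_ne_zero) x)]
    · simp only [hfd, one_mul]
    · simp only [hfd, one_mul]
      exact hg.continuous.integrable_of_hasCompactSupport hs
    · exact (hcc.mul hg.continuous).integrable_of_hasCompactSupport hs.mul_left
  have hsum : ∀ x : EuclideanSpace ℝ (Fin n), fderiv ℝ g x x =
      ∑ i, x i * fderiv ℝ g x (EuclideanSpace.single i 1) := by
    intro x
    have hx : x = ∑ i, x i • EuclideanSpace.single i (1 : ℝ) := by
      have := (EuclideanSpace.basisFun (Fin n) ℝ).sum_repr x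
      simpa using this.symm
    conv_lhs => rw [show fderiv ℝ g x x = fderiv ℝ g x (∑ i, x i • EuclideanSpace.single i (1 : ℝ)) from
      congrArg _ hx]
    simp [map_sum]
  simp_rw [hsum]
  rw [integral_finsetSum _ (fun i _ => (key i).1)]
  simp [fun i => (key i).2]

theorem stmt15 (n : ℕ) (hn : 1 ≤ n) (α : ℝ) (hα : α ≠ ((n : ℝ) - 2) / 2)
    (f : EuclideanSpace ℝ (Fin n) → ℂ)
    (hf : ContDiff ℝ (⊤ : ℕ∞) f) (hsupp : HasCompactSupport f)
    (h0 : (0 : EuclideanSpace ℝ (Fin n)) ∉ tsupport f) :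
    |(n : ℝ) - 2 - 2 * α| / 2 *
      (∫ x, ‖f x‖ ^ 2 / ‖x‖ ^ (2 * (α + 1))) ^ ((1 : ℝ) / 2) ≤
      (∫ x, ‖Rop f x‖ ^ 2 / ‖x‖ ^ (2 * α)) ^ ((1 : ℝ) / 2) := by
  set w : EuclideanSpace ℝ (Fin n) → ℝ := fun x => ‖x‖ ^ (-(2 * (α + 1))) with hw
  have hf1 : ContDiff ℝ 1 f := hf.of_le (by exact_mod_cast le_top)
  have hw0 : ∀ x, 0 ≤ w x := fun x => Real.rpow_nonneg (norm_nonneg _) _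
  have hwd : ∀ x, x ≠ 0 → ContDiffAt ℝ 1 w x := fun x hx =>
    (contDiffAt_norm ℝ hx).rpow_const_of_ne (norm_ne_zero_iff.2 hx)
  have hwf : ∀ x, x ≠ 0 → fderiv ℝ w x x = -(2 * (α + 1)) * w x := by
    intro x hx
    have hxn : ‖x‖ ≠ 0 := norm_ne_zero_iff.2 hx
    have hd : DifferentiableAt ℝ w x := (hwd x hx).differentiableAt one_ne_zero
    have h1 : HasDerivAt (fun t : ℝ => w (t • x)) (fderiv ℝ w x x) 1 := by
      have hl : HasDerivAt (fun t : ℝ => t • x) x 1 := by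
        simpa using (hasDerivAt_id (1 : ℝ)).smul_const x
      have hd' : HasFDerivAt w (fderiv ℝ w x) ((1 : ℝ) • x) := by
        rw [one_smul]; exact hd.hasFDerivAt
      exact hd'.comp_hasDerivAt (1 : ℝ) hl
    have h2 : HasDerivAt (fun t : ℝ => w (t • x)) (-(2 * (α + 1)) * w x) 1 := by
      have h3 : HasDerivAt (fun t : ℝ => t ^ (-(2 * (α + 1))) * w x)
          (-(2 * (α + 1)) * w x) 1 := by
        have := (Real.hasDerivAt_rpow_const (x := 1) (p := -(2 * (α + 1)))
          (Or.inl one_ne_zero)).mul_const (w x)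
        simpa using this
      refine h3.congr_of_eventuallyEq ?_
      filter_upwards [lt_mem_nhds (zero_lt_one' ℝ)] with t ht
      simp only [hw, norm_smul, Real.norm_eq_abs, abs_of_pos ht]
      rw [Real.mul_rpow ht.le (norm_nonneg _)]
    exact h1.unique h2
  have hint : ∀ h : EuclideanSpace ℝ (Fin n) → ℝ, Continuous h →
      (∀ x, x ∉ tsupport f → h x = 0) → Integrable (fun x => h x * w x) := by
    intro h hh hz
    rw [← integrableOn_iff_integrable_of_support_subset (s := tsupport f)]
    · apply ContinuousOn.integrableOn_compact hsupp
      apply hh.continuousOn.mul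
      intro x hx
      exact (hwd x (fun h => h0 (h ▸ hx))).continuousAt.continuousWithinAt
    · intro x hx
      by_contra hc
      exact hx (by simp [hz x hc])
  have hfz : ∀ x, x ∉ tsupport f → f x = 0 := fun x hx => image_eq_zero_of_notMem_tsupport hx
  have hdz : ∀ x, x ∉ tsupport f → fderiv ℝ f x = 0 := fun x hx =>
    image_eq_zero_of_notMem_tsupport (fun h => hx (tsupport_fderiv_subset ℝ h))
  have hDc : Continuous (fun x => fderiv ℝ f x x) :=
    (hf1.continuous_fderiv one_ne_zero).clm_apply continuous_id
  have i1 := hint (fun x => ‖f x‖ ^ 2) (by have := hf1.continuous; fun_prop)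
    (fun x hx => by simp [hfz x hx])
  have i2 := hint (fun x => ‖fderiv ℝ f x x‖ ^ 2) (by fun_prop)
    (fun x hx => by simp [hdz x hx])
  have i3 := hint (fun x => inner ℝ (f x) (fderiv ℝ f x x))
    (hf1.continuous.inner hDc) (fun x hx => by simp [hfz x hx])
  -- the function g
  set g : EuclideanSpace ℝ (Fin n) → ℝ := fun x => ‖f x‖ ^ 2 * w x with hgdef
  have hg : ContDiff ℝ 1 g := by
    rw [contDiff_iff_contDiffAt]
    intro x
    by_cases hx : x = 0
    · subst hx
      have : g =ᶠ[nhds 0] fun _ => 0 := by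
        filter_upwards [notMem_tsupport_iff_eventuallyEq.1 h0] with y hy
        simp [hgdef, hy]
      exact contDiffAt_const.congr_of_eventuallyEq this
    · exact (hf1.norm_sq ℝ).contDiffAt.mul (hwd x hx)
  have hgs : HasCompactSupport g := by
    refine HasCompactSupport.intro hsupp (fun x hx => ?_)
    simp [hgdef, hfz x hx]
  have hgD : ∀ x, fderiv ℝ g x x =
      2 * (inner ℝ (f x) (fderiv ℝ f x x) * w x) + -(2 * (α + 1)) * (‖f x‖ ^ 2 * w x) := by
    intro x
    by_cases hx : x = 0
    · subst hx
      simp [hfz 0 h0]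
    · have e1 := (hf1.differentiable one_ne_zero x).hasFDerivAt.norm_sq
      have e2 := ((hwd x hx).differentiableAt one_ne_zero).hasFDerivAt
      have e3 : HasFDerivAt g _ x := e1.mul e2
      rw [e3.fderiv]
      simp [hwf x hx]
      ring
  have hE := euler_int g hg hgs
  simp_rw [hgD] at hE
  rw [integral_add (i3.const_mul 2) (i1.const_mul _), integral_const_mul, integral_const_mul] at hE
  have eA : ∫ x, ‖f x‖ ^ 2 / ‖x‖ ^ (2 * (α + 1)) = ∫ x, ‖f x‖ ^ 2 * w x := by
    congr 1; ext x
    simp only [hw]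
    rw [Real.rpow_neg (norm_nonneg _), div_eq_mul_inv]
  have eB : ∫ x, ‖Rop f x‖ ^ 2 / ‖x‖ ^ (2 * α) = ∫ x, ‖fderiv ℝ f x x‖ ^ 2 * w x := by
    congr 1; ext x
    by_cases hx : x = 0
    · subst hx; simp [Rop]
    · have hxn : 0 < ‖x‖ := norm_pos_iff.2 hx
      simp only [hw, Rop]
      rw [Real.rpow_neg (norm_nonneg _), show 2 * (α + 1) = 2 * α + 2 by ring,
        Real.rpow_add hxn, norm_smul, norm_inv, norm_norm, Real.rpow_two]
      field_simp
  rw [eA, eB]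
  set A := ∫ x, ‖f x‖ ^ 2 * w x with hA
  set B := ∫ x, ‖fderiv ℝ f x x‖ ^ 2 * w x with hB
  set C := ∫ x, inner ℝ (f x) (fderiv ℝ f x x) * w x with hC
  have hE' : 2 * C + -(2 * (α + 1)) * A = -(n : ℝ) * A := hE
  set c : ℝ := (2 * α + 2 - n) / 2 with hcdef
  have hCA : C = c * A := by rw [hcdef]; linarith
  have hpos : 0 ≤ ∫ x, ‖fderiv ℝ f x x - c • f x‖ ^ 2 * w x :=
    integral_nonneg (fun x => mul_nonneg (sq_nonneg _) (hw0 x))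
  have hexp : ∫ x, ‖fderiv ℝ f x x - c • f x‖ ^ 2 * w x = B + -(2 * c) * C + c ^ 2 * A := by
    rw [hA, hB, hC, ← integral_const_mul, ← integral_const_mul,
      ← integral_add i2 (i3.const_mul _)]
    refine Eq.trans ?_ (integral_add (i2.add (i3.const_mul (-(2 * c)))) (i1.const_mul (c ^ 2)))
    refine integral_congr_ae (Filter.Eventually.of_forall fun x => ?_)
    change ‖fderiv ℝ f x x - c • f x‖ ^ 2 * w x = ‖fderiv ℝ f x x‖ ^ 2 * w x + -(2 * c) * (inner ℝ (f x) (fderiv ℝ f x x) * w x)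
      + c ^ 2 * (‖f x‖ ^ 2 * w x)
    rw [norm_sub_sq_real, inner_smul_right, real_inner_comm, norm_smul, mul_pow,
      Real.norm_eq_abs, sq_abs]
    ring
  have hA0 : 0 ≤ A := integral_nonneg (fun x => mul_nonneg (sq_nonneg _) (hw0 x))
  have hfin : c ^ 2 * A ≤ B := by rw [hexp, hCA] at hpos; nlinarith
  have hcabs : |(n : ℝ) - 2 - 2 * α| / 2 = √(c ^ 2) := by
    rw [Real.sqrt_sq_eq_abs, hcdef, abs_div, abs_two, ← abs_neg]
    congr 2; ring
  rw [← Real.sqrt_eq_rpow, ← Real.sqrt_eq_rpow, hcabs, ← Real.sqrt_mul (sq_nonneg _)]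
  exact Real.sqrt_le_sqrt hfin
end
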